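/- Let V be a separable real Banach space with dual V*, and let f₁, f₂ ∈ D([0,T];V). Then for every v* ∈ V*, the real-valued càdlàg functions t ↦ ⟨f₁(t), v*⟩ and t ↦ ⟨f₂(t), v*⟩ satisfy d_M(⟨f₁, v*⟩, ⟨f₂, v*⟩) ≤ max(‖v*‖, 1) · d_M(f₁, f₂). In particular, convergence in the strong M₁ metric on D([0,T];V) implies weak M₁ convergence, i.e. convergence in d_M of every continuous linear functional applied pathwise. -/

import Mathlib

noncomputable section

open Filter Set Topology

/-- Distance from `v` to the segment joining `v₁` and `v₂`:
`M(v₁, v, v₂) = inf_{α ∈ [0,1]} ‖v − (α v₁ + (1 − α) v₂)‖`. -/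
def segDist {V : Type*} [NormedAddCommGroup V] [NormedSpace ℝ V]
    (v₁ v v₂ : V) : ℝ :=
  sInf {d : ℝ | ∃ α ∈ Set.Icc (0:ℝ) 1, d = ‖v - (α • v₁ + (1 - α) • v₂)‖}

/-- Left limit `f(t−)` of `f` at `t` for the interval starting at `a`, with `f(a−) := f(a)`. -/
def leftLimIn {V : Type*} [NormedAddCommGroup V] (f : ℝ → V) (a t : ℝ) : V :=
  if a < t then Function.leftLim f t else f a

/-- `f` is càdlàg on `[a,b]`: right-continuous at every `t ∈ [a,b)` and
having a left limit at every `t ∈ (a,b]`. -/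
def IsCadlagOn {V : Type*} [NormedAddCommGroup V] (f : ℝ → V) (a b : ℝ) : Prop :=
  (∀ t ∈ Set.Ico a b, Filter.Tendsto f (nhdsWithin t (Set.Ioc t b)) (nhds (f t))) ∧
  (∀ t ∈ Set.Ioc a b, ∃ l, Filter.Tendsto f (nhdsWithin t (Set.Ico a t)) (nhds l))

/-- The extended graph `Γ(f)` of `f` on `[a,b]`. -/
def extGraph {V : Type*} [NormedAddCommGroup V] [NormedSpace ℝ V]
    (f : ℝ → V) (a b : ℝ) : Set (ℝ × V) :=
  {p | p.1 ∈ Set.Icc a b ∧ ∃ α ∈ Set.Icc (0:ℝ) 1,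
      p.2 = α • leftLimIn f a p.1 + (1 - α) • f p.1}

/-- The total order on the extended graph of `f`. -/
def graphLE {V : Type*} [NormedAddCommGroup V] (f : ℝ → V) (a : ℝ) (p q : ℝ × V) : Prop :=
  p.1 < q.1 ∨ (p.1 = q.1 ∧ ‖leftLimIn f a p.1 - p.2‖ ≤ ‖leftLimIn f a p.1 - q.2‖)

/-- `(r, u)` is a parametric representation of the extended graph of `f` on `[a,b]`:
a continuous nondecreasing surjection of `[0,1]` onto `Γ(f)` with the correct endpoints. -/
structure IsParamRep {V : Type*} [NormedAddCommGroup V] [NormedSpace ℝ V]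
    (f : ℝ → V) (a b : ℝ) (r : ℝ → ℝ) (u : ℝ → V) : Prop where
  contOn : ContinuousOn (fun s => (r s, u s)) (Set.Icc 0 1)
  mem : ∀ s ∈ Set.Icc (0:ℝ) 1, (r s, u s) ∈ extGraph f a b
  surj : ∀ p ∈ extGraph f a b, ∃ s ∈ Set.Icc (0:ℝ) 1, (r s, u s) = p
  mono : ∀ s₁ ∈ Set.Icc (0:ℝ) 1, ∀ s₂ ∈ Set.Icc (0:ℝ) 1,
      s₁ ≤ s₂ → graphLE f a (r s₁, u s₁) (r s₂, u s₂)
  init : r 0 = a ∧ u 0 = f a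
  last : r 1 = b ∧ u 1 = f b

/-- The strong `M₁` Skorokhod metric on `D([a,b];V)`. -/
def dM {V : Type*} [NormedAddCommGroup V] [NormedSpace ℝ V]
    (a b : ℝ) (f₁ f₂ : ℝ → V) : ℝ :=
  sInf {d : ℝ | ∃ r₁ u₁ r₂ u₂, IsParamRep f₁ a b r₁ u₁ ∧ IsParamRep f₂ a b r₂ u₂ ∧
    d = max (⨆ s : Set.Icc (0:ℝ) 1, |r₁ s.1 - r₂ s.1|)
            (⨆ s : Set.Icc (0:ℝ) 1, ‖u₁ s.1 - u₂ s.1‖)}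

/-- The oscillation function `M(f; δ)` on `[a,b]`. -/
def oscM {V : Type*} [NormedAddCommGroup V] [NormedSpace ℝ V]
    (f : ℝ → V) (a b δ : ℝ) : ℝ :=
  sSup {d : ℝ | ∃ t₁ t t₂ : ℝ, a ≤ t₁ ∧ t₁ < t ∧ t < t₂ ∧ t₂ ≤ b ∧ t₂ - t₁ ≤ δ ∧
    d = segDist (f t₁) (f t) (f t₂)}

end

open Filter Set Topology Function

section JumpClock

open MeasureTheory ProbabilityTheory

/-- Every countable set is contained in the set of jump times of some right-continuous function
that grows at least as fast as the identity. -/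
theorem exists_stieltjesFunction_leftLim_lt {D : Set ℝ} (hD : D.Countable) :
    ∃ F : StieltjesFunction ℝ, (∀ s t, s ≤ t → t - s ≤ F t - F s) ∧
      ∀ t ∈ D, leftLim F t < F t := by
  obtain ⟨e, he⟩ := (hD.insert 0).exists_eq_range (insert_nonempty _ _)
  have hem : Measurable e := measurable_from_nat
  let μ : Measure ℝ := (poissonMeasure 1).map e
  have : IsProbabilityMeasure μ := Measure.isProbabilityMeasure_map hem.aemeasurable
  refine ⟨StieltjesFunction.id + cdf μ, fun s t hst => ?_, fun t ht => ?_⟩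
  · have := monotone_cdf μ hst
    simp only [StieltjesFunction.add_apply, StieltjesFunction.id_apply, id_eq]
    linarith
  · obtain ⟨n, rfl⟩ : t ∈ range e := he ▸ mem_insert_of_mem _ ht
    have hpos : 0 < (StieltjesFunction.id + cdf μ).measure {e n} := by
      rw [StieltjesFunction.measure_add, measure_cdf]
      refine lt_of_lt_of_le ?_ (Measure.le_add_left le_rfl _)
      rw [Measure.map_apply hem (measurableSet_singleton _)]
      refine lt_of_lt_of_le ?_ (measure_mono (singleton_subset_iff.2 (by simp : n ∈ _)))
      have := poissonMeasure_real_singleton_pos (r := 1) n one_pos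
      rw [measureReal_def] at this
      exact (ENNReal.toReal_pos_iff.1 this).1
    rw [StieltjesFunction.measure_singleton, ENNReal.ofReal_pos] at hpos
    linarith

end JumpClock

section InverseClock

variable {F : StieltjesFunction ℝ}

/-- The jump intervals of a strictly increasing right-continuous function cover the line. -/
theorem exists_leftLim_le_le (hF : ∀ s t, s ≤ t → t - s ≤ F t - F s) (s : ℝ) :
    ∃ t, leftLim F t ≤ s ∧ s ≤ F t := by
  set A : Set ℝ := {t | s ≤ F t}
  have hne : A.Nonempty := by
    refine ⟨max 0 (s - F 0), ?_⟩
    have h1 := hF 0 (max 0 (s - F 0)) (le_max_left _ _)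
    have h2 := le_max_right 0 (s - F 0)
    show s ≤ F _
    linarith
  have hbdd : BddBelow A := by
    refine ⟨min 0 (s - F 0), fun t (ht : s ≤ F t) => ?_⟩
    rcases le_total 0 t with h | h
    · exact (min_le_left _ _).trans h
    · have := hF t 0 h
      exact (min_le_right _ _).trans (by linarith)
  refine ⟨sInf A, ?_, ?_⟩
  · refine le_of_tendsto (F.mono.tendsto_leftLim _) ?_
    filter_upwards [self_mem_nhdsWithin] with t ht
    by_contra! h
    exact absurd (csInf_le hbdd (show t ∈ A from h.le)) (not_le.2 ht)
  · by_contra! h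
    have hev : ∀ᶠ t in 𝓝[≥] sInf A, F t < s :=
      (F.right_continuous (sInf A)).eventually_lt_const h
    obtain ⟨b, hb, hsub⟩ := mem_nhdsGE_iff_exists_Ico_subset.1 hev
    obtain ⟨t, htA, htb⟩ := exists_lt_of_csInf_lt hne hb
    exact absurd (show F t < s from hsub ⟨csInf_le hbdd htA, htb⟩) (not_lt.2 htA)

theorem lt_leftLim_of_lt (hF : ∀ s t, s ≤ t → t - s ≤ F t - F s) {s t : ℝ} (h : s < t) :
    F s < leftLim F t := by
  have h1 := hF s ((s + t) / 2) (by linarith)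
  have h2 : F ((s + t) / 2) ≤ leftLim F t := F.mono.le_leftLim (by linarith)
  linarith

/-- The continuous inverse of a strictly increasing right-continuous function. -/
theorem exists_monotone_continuous_inverse (hF : ∀ s t, s ≤ t → t - s ≤ F t - F s) :
    ∃ r : ℝ → ℝ, Monotone r ∧ Continuous r ∧
      ∀ s t, r s = t ↔ leftLim F t ≤ s ∧ s ≤ F t := by
  choose r hr using exists_leftLim_le_le hF
  have hle : ∀ {s s' t t'}, s ≤ s' → leftLim F t ≤ s → s' ≤ F t' → t ≤ t' := by
    intro s s' t t' hs h1 h2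
    by_contra! h
    linarith [lt_leftLim_of_lt hF h]
  have hchar : ∀ s t, r s = t ↔ leftLim F t ≤ s ∧ s ≤ F t := fun s t =>
    ⟨fun h => h ▸ hr s, fun h =>
      le_antisymm (hle le_rfl (hr s).1 h.2) (hle le_rfl h.1 (hr s).2)⟩
  have hmono : Monotone r := fun s s' h => hle h (hr s).1 (hr s').2
  refine ⟨r, hmono, hmono.continuous_of_surjective fun t => ⟨F t, ?_⟩, hchar⟩
  exact (hchar _ _).2 ⟨F.mono.leftLim_le le_rfl, le_rfl⟩

end InverseClock

section Jumps

variable {V : Type*} [NormedAddCommGroup V]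

theorem tendsto_leftLim_nhdsGT {g : ℝ → V} (hl : ∀ t, ∃ l, Tendsto g (𝓝[<] t) (𝓝 l)) {t : ℝ}
    {y : V} (hg : Tendsto g (𝓝[>] t) (𝓝 y)) : Tendsto (leftLim g) (𝓝[>] t) (𝓝 y) := by
  refine (Metric.nhds_basis_closedBall.tendsto_right_iff).2 fun ε hε => ?_
  obtain ⟨b, hb, hsub⟩ := mem_nhdsGT_iff_exists_Ioo_subset.1
    (hg (Metric.closedBall_mem_nhds y hε))
  filter_upwards [Ioo_mem_nhdsGT hb] with x hx
  refine Metric.isClosed_closedBall.mem_of_tendsto (tendsto_leftLim_of_tendsto (hl x)) ?_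
  filter_upwards [Ioo_mem_nhdsLT hx.1] with z hz
  exact hsub ⟨hz.1, hz.2.trans hx.2⟩

theorem tendsto_leftLim_nhdsLT {g : ℝ → V} {t : ℝ} (hl : ∃ l, Tendsto g (𝓝[<] t) (𝓝 l)) :
    Tendsto (leftLim g) (𝓝[<] t) (𝓝 (leftLim g t)) :=
  (continuousWithinAt_leftLim_Iic (tendsto_leftLim_of_tendsto hl)).mono_left (nhdsWithin_mono _ Iio_subset_Iic_self)

/-- A càdlàg function has countably many jumps. -/
theorem countable_setOf_leftLim_ne {g : ℝ → V} (hr : ∀ t, Tendsto g (𝓝[>] t) (𝓝 (g t)))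
    (hl : ∀ t, ∃ l, Tendsto g (𝓝[<] t) (𝓝 l)) : {t | leftLim g t ≠ g t}.Countable := by
  have hjump : ∀ t, Tendsto (fun x => ‖leftLim g x - g x‖) (𝓝[≠] t) (𝓝 0) := by
    intro t
    rw [← Iio_union_Ioi, nhdsWithin_union, tendsto_sup]
    constructor
    · simpa using ((tendsto_leftLim_nhdsLT (hl t)).sub (tendsto_leftLim_of_tendsto (hl t))).norm
    · simpa using ((tendsto_leftLim_nhdsGT hl (hr t)).sub (hr t)).norm
  have hcount : ∀ n : ℕ, {t | 1 / ((n : ℝ) + 1) < ‖leftLim g t - g t‖}.Countable := by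
    intro n
    refine (HereditarilyLindelofSpace.isLindelof _).countable_of_isDiscrete ?_
    refine isDiscrete_iff_nhdsNE.2 fun t _ => ?_
    have hev := (hjump t).eventually_lt_const (Nat.one_div_pos_of_nat (α := ℝ) (n := n))
    rw [← disjoint_iff, disjoint_principal_right]
    filter_upwards [hev] with x hx using not_lt.2 hx.le
  refine (countable_iUnion hcount).mono fun t ht => ?_
  obtain ⟨n, hn⟩ := exists_nat_one_div_lt (norm_pos_iff.2 (sub_ne_zero.2 ht))
  exact mem_iUnion.2 ⟨n, hn⟩

end Jumps

section Parametrization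

variable {V : Type*} [NormedAddCommGroup V] [NormedSpace ℝ V]

/-- The point at position `s` on the jump of `g` at `t`, when the clock `F` sweeps
the jump from `leftLim F t` to `F t`. -/
noncomputable def jumpPoint (F : StieltjesFunction ℝ) (g : ℝ → V) (t s : ℝ) : V :=
  ((F t - s) / (F t - leftLim F t)) • leftLim g t +
    (1 - (F t - s) / (F t - leftLim F t)) • g t

theorem jumpPoint_coeff_mem {F : StieltjesFunction ℝ} {t s : ℝ} (h₁ : leftLim F t ≤ s)
    (h₂ : s ≤ F t) : (F t - s) / (F t - leftLim F t) ∈ Icc (0 : ℝ) 1 :=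
  ⟨div_nonneg (by linarith) (by linarith), div_le_one_of_le₀ (by linarith) (by linarith)⟩

theorem jumpPoint_right (F : StieltjesFunction ℝ) (g : ℝ → V) (t : ℝ) :
    jumpPoint F g t (F t) = g t := by
  simp [jumpPoint]

theorem jumpPoint_left {F : StieltjesFunction ℝ} {g : ℝ → V} {t : ℝ}
    (h : leftLim g t ≠ g t → leftLim F t < F t) :
    jumpPoint F g t (leftLim F t) = leftLim g t := by
  by_cases hg : leftLim g t = g t
  · simp [jumpPoint, hg, ← add_smul]
  · simp [jumpPoint, div_self (sub_pos.2 (h hg)).ne']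

theorem continuous_jumpPoint (F : StieltjesFunction ℝ) (g : ℝ → V) (t : ℝ) :
    Continuous (jumpPoint F g t) := by
  unfold jumpPoint
  fun_prop

theorem tendsto_jumpPoint {F : StieltjesFunction ℝ} {g : ℝ → V} {r : ℝ → ℝ} {l : Filter ℝ}
    {y : V} (hr : ∀ s, leftLim F (r s) ≤ s ∧ s ≤ F (r s))
    (h₁ : Tendsto (fun s => leftLim g (r s)) l (𝓝 y))
    (h₂ : Tendsto (fun s => g (r s)) l (𝓝 y)) :
    Tendsto (fun s => jumpPoint F g (r s) s) l (𝓝 y) := by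
  have h0 : Tendsto (fun s => ((F (r s) - s) / (F (r s) - leftLim F (r s))) •
      (leftLim g (r s) - g (r s))) l (𝓝 0) := by
    refine squeeze_zero_norm (fun s => ?_) (by simpa using (h₁.sub h₂).norm)
    obtain ⟨ha, hb⟩ := jumpPoint_coeff_mem (hr s).1 (hr s).2
    rw [norm_smul, Real.norm_of_nonneg ha]
    exact mul_le_of_le_one_left (norm_nonneg _) hb
  refine (by simpa using h0.add h₂ : Tendsto _ l (𝓝 y)).congr fun s => ?_
  simp only [jumpPoint]
  module

theorem continuous_jumpPoint_comp {F : StieltjesFunction ℝ} {g : ℝ → V} {r : ℝ → ℝ}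
    (hg : ∀ t, Tendsto g (𝓝[>] t) (𝓝 (g t))) (hl : ∀ t, ∃ l, Tendsto g (𝓝[<] t) (𝓝 l))
    (hF : ∀ t, leftLim g t ≠ g t → leftLim F t < F t) (hmono : Monotone r)
    (hcont : Continuous r) (hr : ∀ s t, r s = t ↔ leftLim F t ≤ s ∧ s ≤ F t) :
    Continuous (fun s => jumpPoint F g (r s) s) := by
  refine continuous_iff_continuousAt.2 fun s => ?_
  obtain ⟨h₁, h₂⟩ := (hr s (r s)).1 rfl
  have hbd : ∀ s, leftLim F (r s) ≤ s ∧ s ≤ F (r s) := fun s => (hr s _).1 rfl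
  rw [continuousAt_iff_continuous_left'_right']
  constructor
  · rcases h₁.eq_or_lt with h | h
    · have hlt : Tendsto r (𝓝[<] s) (𝓝[<] (r s)) := by
        refine tendsto_nhdsWithin_iff.2 ⟨hcont.continuousAt.mono_left nhdsWithin_le_nhds, ?_⟩
        filter_upwards [self_mem_nhdsWithin] with x (hx : x < s)
        refine lt_of_le_of_ne (hmono hx.le) fun e => ?_
        have := ((hr x (r s)).1 e).1
        linarith
      have hval : jumpPoint F g (r s) s = leftLim g (r s) := by
        rw [← jumpPoint_left (hF (r s)), h]
      rw [ContinuousWithinAt, hval]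
      exact tendsto_jumpPoint hbd ((tendsto_leftLim_nhdsLT (hl _)).comp hlt)
        ((tendsto_leftLim_of_tendsto (hl _)).comp hlt)
    · refine (continuous_jumpPoint F g (r s)).continuousWithinAt.congr_of_eventuallyEq ?_ rfl
      filter_upwards [Ioo_mem_nhdsLT h] with x hx
      rw [(hr x (r s)).2 ⟨hx.1.le, hx.2.le.trans h₂⟩]
  · rcases h₂.eq_or_lt with h | h
    · have hgt : Tendsto r (𝓝[>] s) (𝓝[>] (r s)) := by
        refine tendsto_nhdsWithin_iff.2 ⟨hcont.continuousAt.mono_left nhdsWithin_le_nhds, ?_⟩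
        filter_upwards [self_mem_nhdsWithin] with x (hx : s < x)
        refine lt_of_le_of_ne (hmono hx.le) fun e => ?_
        have := ((hr x (r s)).1 e.symm).2
        linarith
      have hval : jumpPoint F g (r s) s = g (r s) := by
        rw [← jumpPoint_right F g (r s), ← h]
      rw [ContinuousWithinAt, hval]
      exact tendsto_jumpPoint hbd ((tendsto_leftLim_nhdsGT hl (hg _)).comp hgt)
        ((hg _).comp hgt)
    · refine (continuous_jumpPoint F g (r s)).continuousWithinAt.congr_of_eventuallyEq ?_ rfl
      filter_upwards [Ioo_mem_nhdsGT h] with x hx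
      rw [(hr x (r s)).2 ⟨h₁.trans hx.1.le, hx.2.le⟩]

end Parametrization

section Cadlag

variable {V : Type*} [NormedAddCommGroup V] {f : ℝ → V} {T : ℝ}

theorem IsCadlagOn.exists_tendsto_nhdsLT (hf : IsCadlagOn f 0 T) {t : ℝ} (ht : t ∈ Ioc 0 T) :
    ∃ l, Tendsto f (𝓝[<] t) (𝓝 l) := by
  obtain ⟨l, hl⟩ := hf.2 t ht
  exact ⟨l, by rwa [nhdsWithin_Ico_eq_nhdsLT ht.1] at hl⟩

/-- A càdlàg function on `[0,T]` extends to a càdlàg function on the line, with the same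
left limits. -/
theorem IsCadlagOn.exists_extension (hT : 0 < T) (hf : IsCadlagOn f 0 T) :
    ∃ g : ℝ → V, (∀ t, Tendsto g (𝓝[>] t) (𝓝 (g t))) ∧
      (∀ t, ∃ l, Tendsto g (𝓝[<] t) (𝓝 l)) ∧
      ∀ t ∈ Icc 0 T, g t = f t ∧ leftLim g t = leftLimIn f 0 t := by
  set g : ℝ → V := fun t => f (max 0 (min T t)) with hgdef
  have hIcc : ∀ t, 0 ≤ t → t ≤ T → g t = f t := fun t h0 h1 => by
    simp [hgdef, min_eq_right h1, max_eq_right h0]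
  have hneg : ∀ t, t ≤ 0 → g t = f 0 := fun t h => by
    simp [hgdef, min_eq_right (h.trans hT.le), max_eq_left h]
  have hbig : ∀ t, T ≤ t → g t = f T := fun t h => by
    simp [hgdef, min_eq_left h, max_eq_right hT.le]
  have hleft0 : ∀ t, t ≤ 0 → Tendsto g (𝓝[<] t) (𝓝 (f 0)) := fun t ht =>
    tendsto_const_nhds.congr' (by
      filter_upwards [self_mem_nhdsWithin] with x (hx : x < t)
      exact (hneg x (hx.le.trans ht)).symm)
  have hgf : ∀ t ∈ Ioc 0 T, f =ᶠ[𝓝[<] t] g := fun t ht => by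
    filter_upwards [Ioo_mem_nhdsLT ht.1] with x hx
    exact (hIcc x hx.1.le (hx.2.le.trans ht.2)).symm
  refine ⟨g, fun t => ?_, fun t => ?_, fun t ht => ⟨hIcc t ht.1 ht.2, ?_⟩⟩
  · rcases lt_or_ge t 0 with h0 | h0
    · rw [hneg t h0.le]
      refine tendsto_const_nhds.congr' ?_
      filter_upwards [Ioo_mem_nhdsGT h0] with x hx
      exact (hneg x hx.2.le).symm
    rcases lt_or_ge t T with h1 | h1
    · have := hf.1 t ⟨h0, h1⟩
      rw [nhdsWithin_Ioc_eq_nhdsGT h1] at this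
      rw [hIcc t h0 h1.le]
      refine this.congr' ?_
      filter_upwards [Ioo_mem_nhdsGT h1] with x hx
      exact (hIcc x (h0.trans hx.1.le) hx.2.le).symm
    · rw [hbig t h1]
      refine tendsto_const_nhds.congr' ?_
      filter_upwards [self_mem_nhdsWithin] with x (hx : t < x)
      exact (hbig x (h1.trans hx.le)).symm
  · rcases le_or_gt t 0 with h0 | h0
    · exact ⟨_, hleft0 t h0⟩
    rcases le_or_gt t T with h1 | h1
    · obtain ⟨l, hl⟩ := hf.exists_tendsto_nhdsLT ⟨h0, h1⟩
      exact ⟨l, hl.congr' (hgf t ⟨h0, h1⟩)⟩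
    · refine ⟨f T, tendsto_const_nhds.congr' ?_⟩
      filter_upwards [Ioo_mem_nhdsLT h1] with x hx
      exact (hbig x hx.1.le).symm
  · rcases ht.1.eq_or_lt with h0 | h0
    · subst h0
      simpa [leftLimIn] using leftLim_eq_of_tendsto (hleft0 0 le_rfl)
    · have hl := tendsto_leftLim_of_tendsto (hf.exists_tendsto_nhdsLT ⟨h0, ht.2⟩)
      rw [leftLimIn, if_pos h0]
      exact leftLim_eq_of_tendsto (hl.congr' (hgf t ⟨h0, ht.2⟩))

theorem IsCadlagOn.leftLimIn_clm_comp [NormedSpace ℝ V] (hf : IsCadlagOn f 0 T) (vs : V →L[ℝ] ℝ)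
    {t : ℝ} (ht : t ∈ Icc 0 T) : leftLimIn (fun t => vs (f t)) 0 t = vs (leftLimIn f 0 t) := by
  rcases ht.1.eq_or_lt with h0 | h0
  · simp [leftLimIn, ← h0]
  · have hl := tendsto_leftLim_of_tendsto (hf.exists_tendsto_nhdsLT ⟨h0, ht.2⟩)
    simp only [leftLimIn, if_pos h0]
    exact leftLim_eq_of_tendsto ((vs.continuous.tendsto _).comp hl)

end Cadlag

section ParamRep

variable {V : Type*} [NormedAddCommGroup V] [NormedSpace ℝ V] {f : ℝ → V} {T : ℝ}

theorem norm_sub_smul_add (α : ℝ) (hα : α ≤ 1) (x y : V) :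
    ‖x - (α • x + (1 - α) • y)‖ = (1 - α) * ‖x - y‖ := by
  rw [show x - (α • x + (1 - α) • y) = (1 - α) • (x - y) by module, norm_smul,
    Real.norm_of_nonneg (by linarith)]

/-- Every càdlàg function has a parametric representation. -/
theorem IsCadlagOn.exists_isParamRep (hT : 0 < T) (hf : IsCadlagOn f 0 T) :
    ∃ r u, IsParamRep f 0 T r u := by
  obtain ⟨g, hg, hl, hgf⟩ := hf.exists_extension hT
  obtain ⟨F, hF, hFj⟩ := exists_stieltjesFunction_leftLim_lt (countable_setOf_leftLim_ne hg hl)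
  obtain ⟨r, hmono, hcont, hr⟩ := exists_monotone_continuous_inverse hF
  have hucont := continuous_jumpPoint_comp hg hl hFj hmono hcont hr
  have hrF : ∀ t, r (F t) = t := fun t => (hr _ _).2 ⟨F.mono.leftLim_le le_rfl, le_rfl⟩
  have hL : 0 < F T - F 0 := by linarith [hF 0 T hT.le]
  set σ : ℝ → ℝ := fun x => F 0 + x * (F T - F 0) with hσ
  have hσcont : Continuous σ := by fun_prop
  have hσmono : Monotone σ := fun x y h => by
    simp only [hσ]
    gcongr
  have hσ0 : σ 0 = F 0 := by simp [hσ]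
  have hσ1 : σ 1 = F T := by simp [hσ]
  have hrσ : ∀ x ∈ Icc (0 : ℝ) 1, r (σ x) ∈ Icc 0 T := fun x hx => by
    constructor
    · rw [← hrF 0, ← hσ0]; exact hmono (hσmono hx.1)
    · rw [← hrF T, ← hσ1]; exact hmono (hσmono hx.2)
  have hbd : ∀ s, leftLim F (r s) ≤ s ∧ s ≤ F (r s) := fun s => (hr s _).1 rfl
  refine ⟨fun x => r (σ x), fun x => jumpPoint F g (r (σ x)) (σ x),
    ⟨((hcont.comp hσcont).prodMk (hucont.comp hσcont)).continuousOn, ?_, ?_, ?_, ?_, ?_⟩⟩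
  · intro x hx
    refine ⟨hrσ x hx, _, jumpPoint_coeff_mem (hbd (σ x)).1 (hbd (σ x)).2, ?_⟩
    obtain ⟨h1, h2⟩ := hgf _ (hrσ x hx)
    simp only [jumpPoint, h1, h2]
  · rintro ⟨t, v⟩ ⟨ht, α, hα, hv⟩
    simp only at ht hv
    obtain ⟨h1, h2⟩ := hgf t ht
    rw [← h1, ← h2] at hv
    obtain ⟨s, hs0, hsT, hst, hsv⟩ :
        ∃ s, F 0 ≤ s ∧ s ≤ F T ∧ r s = t ∧ jumpPoint F g t s = v := by
      by_cases hj : leftLim g t = g t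
      · refine ⟨F t, F.mono ht.1, F.mono ht.2, hrF t, ?_⟩
        rw [jumpPoint_right, hv, hj, ← add_smul]
        simp
      · have hpos := sub_pos.2 (hFj t hj)
        have h0 : 0 < t := ht.1.lt_of_ne' fun h => hj (by
          rw [h1, h2, leftLimIn, if_neg (by simp [h]), h])
        have hb1 : leftLim F t ≤ F t - α * (F t - leftLim F t) := by nlinarith [hα.2]
        have hb2 : F t - α * (F t - leftLim F t) ≤ F t := by nlinarith [hα.1]
        refine ⟨F t - α * (F t - leftLim F t), (F.mono.le_leftLim h0).trans hb1,
          hb2.trans (F.mono ht.2), (hr _ _).2 ⟨hb1, hb2⟩, ?_⟩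
        rw [jumpPoint, sub_sub_cancel, mul_div_cancel_right₀ _ hpos.ne', hv]
    have hσs : σ ((s - F 0) / (F T - F 0)) = s := by
      simp only [hσ]
      rw [div_mul_cancel₀ _ hL.ne']
      ring
    refine ⟨(s - F 0) / (F T - F 0), ⟨div_nonneg (by linarith) hL.le,
      div_le_one_of_le₀ (by linarith) hL.le⟩, ?_⟩
    simp only [hσs, hst, hsv]
  · intro x hx y hy hxy
    rcases (hmono (hσmono hxy)).lt_or_eq with h | h
    · exact Or.inl h
    · refine Or.inr ⟨h, ?_⟩
      have hbx := hbd (σ x)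
      have hby := hbd (σ y)
      have ht := hrσ y hy
      simp only [h] at hbx ⊢
      rw [← (hgf _ ht).2, jumpPoint, jumpPoint,
        norm_sub_smul_add _ (jumpPoint_coeff_mem hbx.1 hbx.2).2,
        norm_sub_smul_add _ (jumpPoint_coeff_mem hby.1 hby.2).2]
      have := hσmono hxy
      have hnn : 0 ≤ F (r (σ y)) - leftLim F (r (σ y)) := by linarith
      gcongr
  · simp [hσ0, hrF, jumpPoint_right, (hgf 0 ⟨le_rfl, hT.le⟩).1]
  · simp [hσ1, hrF, jumpPoint_right, (hgf T ⟨hT.le, le_rfl⟩).1]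

theorem IsParamRep.clm_comp {r : ℝ → ℝ} {u : ℝ → V} (hf : IsCadlagOn f 0 T)
    (h : IsParamRep f 0 T r u) (vs : V →L[ℝ] ℝ) :
    IsParamRep (fun t => vs (f t)) 0 T r (fun s => vs (u s)) where
  contOn := h.contOn.fst.prodMk (vs.continuous.comp_continuousOn h.contOn.snd)
  mem s hs := by
    obtain ⟨ht, α, hα, hv⟩ := h.mem s hs
    refine ⟨ht, α, hα, ?_⟩
    simp only at ht hv ⊢
    rw [hf.leftLimIn_clm_comp vs ht, hv]
    simp
  surj := by
    rintro ⟨t, v⟩ ⟨ht, α, hα, hv⟩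
    simp only at ht hv
    obtain ⟨s, hs, hsp⟩ := h.surj (t, α • leftLimIn f 0 t + (1 - α) • f t) ⟨ht, α, hα, rfl⟩
    refine ⟨s, hs, ?_⟩
    rw [Prod.mk.injEq] at hsp ⊢
    refine ⟨hsp.1, ?_⟩
    rw [hsp.2, hv, hf.leftLimIn_clm_comp vs ht]
    simp
  mono s₁ hs₁ s₂ hs₂ hs := by
    rcases h.mono s₁ hs₁ s₂ hs₂ hs with hlt | ⟨heq, hle⟩
    · exact Or.inl hlt
    · refine Or.inr ⟨heq, ?_⟩
      obtain ⟨ht, α, hα, hv⟩ := h.mem s₁ hs₁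
      obtain ⟨-, β, hβ, hw⟩ := h.mem s₂ hs₂
      simp only at ht hv hw heq hle ⊢
      rw [← heq] at hw
      rw [hv, hw, norm_sub_smul_add _ hα.2, norm_sub_smul_add _ hβ.2] at hle
      rw [hf.leftLimIn_clm_comp vs ht, ← map_sub, ← map_sub, hv, hw,
        show ∀ (c : ℝ) (x y : V), x - (c • x + (1 - c) • y) = (1 - c) • (x - y) by
          intros; module,
        show ∀ (c : ℝ) (x y : V), x - (c • x + (1 - c) • y) = (1 - c) • (x - y) by
          intros; module, map_smul, map_smul, norm_smul, norm_smul,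
        Real.norm_of_nonneg (sub_nonneg.2 hα.2), Real.norm_of_nonneg (sub_nonneg.2 hβ.2)]
      rcases (norm_nonneg (leftLimIn f 0 (r s₁) - f (r s₁))).eq_or_lt with h0 | h0
      · simp [norm_eq_zero.1 h0.symm]
      · exact mul_le_mul_of_nonneg_right (le_of_mul_le_mul_right hle h0) (norm_nonneg _)
  init := ⟨h.init.1, by rw [h.init.2]⟩
  last := ⟨h.last.1, by rw [h.last.2]⟩

theorem dM_nonneg (a b : ℝ) (f₁ f₂ : ℝ → V) : 0 ≤ dM a b f₁ f₂ := by
  refine Real.sInf_nonneg ?_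
  rintro d ⟨r₁, u₁, r₂, u₂, -, -, rfl⟩
  exact le_max_of_le_left (Real.iSup_nonneg fun _ => abs_nonneg _)

theorem dM_clm_comp_le {f₁ f₂ : ℝ → V} (hT : 0 < T) (h₁ : IsCadlagOn f₁ 0 T)
    (h₂ : IsCadlagOn f₂ 0 T) (vs : V →L[ℝ] ℝ) :
    dM 0 T (fun t => vs (f₁ t)) (fun t => vs (f₂ t)) ≤ max ‖vs‖ 1 * dM 0 T f₁ f₂ := by
  have hC : 0 < max ‖vs‖ 1 := lt_max_of_lt_right one_pos
  rw [← div_le_iff₀' hC]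
  obtain ⟨r₁, u₁, hp₁⟩ := h₁.exists_isParamRep hT
  obtain ⟨r₂, u₂, hp₂⟩ := h₂.exists_isParamRep hT
  refine le_csInf ⟨_, r₁, u₁, r₂, u₂, hp₁, hp₂, rfl⟩ ?_
  clear! r₁ u₁ r₂ u₂
  rintro d ⟨r₁, u₁, r₂, u₂, hp₁, hp₂, rfl⟩
  rw [div_le_iff₀' hC]
  have hle : dM 0 T (fun t => vs (f₁ t)) (fun t => vs (f₂ t)) ≤
      max (⨆ s : Icc (0 : ℝ) 1, |r₁ s.1 - r₂ s.1|)
        (⨆ s : Icc (0 : ℝ) 1, ‖vs (u₁ s.1) - vs (u₂ s.1)‖) := by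
    refine csInf_le ⟨0, ?_⟩ ⟨r₁, _, r₂, _, hp₁.clm_comp h₁ vs, hp₂.clm_comp h₂ vs, rfl⟩
    rintro d ⟨_, _, _, _, -, -, rfl⟩
    exact le_max_of_le_left (Real.iSup_nonneg fun _ => abs_nonneg _)
  refine hle.trans ?_
  have hbdd : BddAbove (range fun s : Icc (0 : ℝ) 1 => ‖u₁ s.1 - u₂ s.1‖) := by
    have := (isCompact_Icc.image_of_continuousOn
      (hp₁.contOn.snd.sub hp₂.contOn.snd).norm).bddAbove
    rwa [image_eq_range] at this
  refine max_le ?_ ?_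
  · refine (le_max_left _ _).trans (le_mul_of_one_le_left ?_ (le_max_right _ _))
    exact le_max_of_le_left (Real.iSup_nonneg fun _ => abs_nonneg _)
  · refine ciSup_le fun s => ?_
    rw [← map_sub]
    refine (vs.le_opNorm _).trans ?_
    gcongr
    · exact le_max_left _ _
    · exact le_max_of_le_right (le_ciSup hbdd s)

end ParamRep

/-- for a separable real Banach space `V`, `f₁, f₂ ∈ D([0,T];V)` and every
`v* ∈ V*` one has `d_M(⟨f₁,v*⟩, ⟨f₂,v*⟩) ≤ max(‖v*‖, 1) · d_M(f₁, f₂)`; in particular,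
strong `M₁` convergence implies weak `M₁` convergence. -/
theorem dM_comp_le_and_weak_convergence {V : Type*} [NormedAddCommGroup V] [NormedSpace ℝ V]
    [CompleteSpace V] [TopologicalSpace.SeparableSpace V]
    (T : ℝ) (hT : 0 < T) :
    (∀ f₁ f₂ : ℝ → V, IsCadlagOn f₁ 0 T → IsCadlagOn f₂ 0 T → ∀ vs : V →L[ℝ] ℝ,
      dM 0 T (fun t => vs (f₁ t)) (fun t => vs (f₂ t)) ≤ max ‖vs‖ 1 * dM 0 T f₁ f₂) ∧
    (∀ (F : ℕ → ℝ → V) (f : ℝ → V), (∀ n, IsCadlagOn (F n) 0 T) → IsCadlagOn f 0 T →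
      Filter.Tendsto (fun n => dM 0 T (F n) f) Filter.atTop (nhds 0) →
      ∀ vs : V →L[ℝ] ℝ,
        Filter.Tendsto (fun n => dM 0 T (fun t => vs (F n t)) (fun t => vs (f t)))
          Filter.atTop (nhds 0)) := by
  have hle : ∀ f₁ f₂ : ℝ → V, IsCadlagOn f₁ 0 T → IsCadlagOn f₂ 0 T → ∀ vs : V →L[ℝ] ℝ,
      dM 0 T (fun t => vs (f₁ t)) (fun t => vs (f₂ t)) ≤ max ‖vs‖ 1 * dM 0 T f₁ f₂ :=
    fun f₁ f₂ h₁ h₂ vs => dM_clm_comp_le hT h₁ h₂ vs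
  refine ⟨hle, fun F f hF hf hconv vs => ?_⟩
  exact squeeze_zero (fun n => dM_nonneg _ _ _ _) (fun n => hle (F n) f (hF n) hf vs)
    (by simpa using hconv.const_mul (max ‖vs‖ 1))
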